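/- For all t ∈ (0, 1/64) the following eight identities hold: I_{2,1}(t) = (1/2)J₂(t) − (1/2)J₃(t); I_{3,1}(t) = (1/4)J₂(t) − (1/4)J₃(t); I_{4,1}(t) = (1/7)J₂(t) − (1/7)J₃(t) − (4/7)t·J₂(t); I_{5,1}(t) = (5/56)J₂(t) − (5/56)J₃(t) − (6/7)t·J₂(t); I_{6,1}(t) = (5/84)J₂(t) − (5/84)J₃(t) − (4/7)t·J₂(t) − (2/3)t·J₃(t); I_{2,2}(t) = (1/6)J₂(t) − (1/6)J₃(t) − (1/3)t·J₁(t); I_{4,2}(t) = (1/28)J₂(t) − (1/28)J₃(t) − (1/7)t·J₂(t); I_{5,2}(t) = (5/252)J₂(t) − (5/252)J₃(t) − (4/21)t·J₂(t) + (1/9)t·J₃(t). -/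

import Mathlib

open MeasureTheory Set Filter

/-- The region bounded by the real oval of `{x^2 y (1-x-y) = t}` in the first quadrant. -/
def Δset (t : ℝ) : Set (ℝ × ℝ) :=
  {z : ℝ × ℝ | 0 < z.1 ∧ 0 < z.2 ∧ t ≤ z.1 ^ 2 * z.2 * (1 - z.1 - z.2)}

/-- The Abelian integral `I_{i,j}(t) = ∬_{Δ(t)} x^i y^j dx dy` (integer powers). -/
noncomputable def Iab (i j : ℤ) (t : ℝ) : ℝ :=
  ∫ z in Δset t, z.1 ^ i * z.2 ^ j

noncomputable def J1 (t : ℝ) : ℝ := Iab 0 0 t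
noncomputable def J2 (t : ℝ) : ℝ := Iab 2 0 t
noncomputable def J3 (t : ℝ) : ℝ := Iab 3 0 t

/-- Half the length of the vertical slice of `Δset t` over `x ∈ (0, 1]`. -/
noncomputable def sliceRadius (t x : ℝ) : ℝ := √((1 - x) ^ 2 / 4 - t / x ^ 2)

/-- The vertical slices of `Δset t` are intervals centred at `(1 - x) / 2`. -/
lemma mem_Δset_iff {t x : ℝ} (ht : 0 < t) (hx : 0 < x) (y : ℝ) :
    (x, y) ∈ Δset t ↔ (y - (1 - x) / 2) ^ 2 ≤ (1 - x) ^ 2 / 4 - t / x ^ 2 ∧ x ≤ 1 := by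
  have hx2 : 0 < x ^ 2 := by positivity
  have key : t ≤ x ^ 2 * y * (1 - x - y) ↔
      (y - (1 - x) / 2) ^ 2 ≤ (1 - x) ^ 2 / 4 - t / x ^ 2 := by
    rw [mul_assoc, ← div_le_iff₀' hx2]
    constructor <;> intro h <;> nlinarith
  simp only [Δset, mem_ofPred_eq, ← key]
  constructor
  · rintro ⟨-, hy, h⟩
    have : 0 < 1 - x - y := pos_of_mul_pos_right (ht.trans_le h) (by positivity)
    exact ⟨h, by linarith⟩
  · rintro ⟨h, hx1⟩
    have h1 : 0 < y * (1 - x - y) := by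
      refine pos_of_mul_pos_right (a := x ^ 2) ?_ hx2.le
      rw [← mul_assoc]
      exact ht.trans_le h
    refine ⟨hx, ?_, h⟩
    by_contra! hy
    nlinarith

lemma Δset_subset {t : ℝ} (ht : 0 < t) : Δset t ⊆ Ioc 0 1 ×ˢ Icc 0 1 := by
  rintro ⟨x, y⟩ ⟨hx, hy, h⟩
  simp only at hx hy h
  have : 0 < 1 - x - y := pos_of_mul_pos_right (ht.trans_le h) (by positivity)
  exact ⟨⟨hx, by simp only; linarith⟩, ⟨hy.le, by simp only; linarith⟩⟩

lemma measurableSet_Δset (t : ℝ) : MeasurableSet (Δset t) := by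
  have h1 : MeasurableSet {z : ℝ × ℝ | 0 < z.1} := measurableSet_lt (by fun_prop) (by fun_prop)
  have h2 : MeasurableSet {z : ℝ × ℝ | 0 < z.2} := measurableSet_lt (by fun_prop) (by fun_prop)
  have h3 : MeasurableSet {z : ℝ × ℝ | t ≤ z.1 ^ 2 * z.2 * (1 - z.1 - z.2)} :=
    measurableSet_le (by fun_prop) (by fun_prop)
  exact h1.inter (h2.inter h3)

lemma integrableOn_Δset {t : ℝ} (ht : 0 < t) {f : ℝ × ℝ → ℝ} (hf : Continuous f) :
    IntegrableOn f (Δset t) := by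
  refine IntegrableOn.mono_set (t := Icc (0 : ℝ) 1 ×ˢ Icc (0 : ℝ) 1) ?_ ?_
  · exact hf.continuousOn.integrableOn_compact (isCompact_Icc.prod isCompact_Icc)
  · exact (Δset_subset ht).trans (prod_mono Ioc_subset_Icc_self subset_rfl)

/-- Fubini's theorem for monomials on `Δset t`. -/
lemma Iab_eq_intervalIntegral {t : ℝ} (ht : 0 < t) (n j : ℕ) :
    Iab n j t = ∫ x in (0 : ℝ)..1, x ^ n *
      ((((1 - x) / 2 + sliceRadius t x) ^ (j + 1) - ((1 - x) / 2 - sliceRadius t x) ^ (j + 1)) /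
        (j + 1)) := by
  have hint : Integrable ((Δset t).indicator fun z : ℝ × ℝ => z.1 ^ n * z.2 ^ j) :=
    (integrable_indicator_iff (measurableSet_Δset t)).2 (integrableOn_Δset ht (by fun_prop))
  simp only [Iab, zpow_natCast]
  rw [← integral_indicator (measurableSet_Δset t), Measure.volume_eq_prod,
    integral_prod _ (by rwa [← Measure.volume_eq_prod]),
    intervalIntegral.integral_of_le zero_le_one, ← integral_indicator measurableSet_Ioc]
  congr 1
  ext x
  by_cases hx : x ∈ Ioc (0 : ℝ) 1
  · rw [indicator_of_mem hx, ← integral_pow, ← intervalIntegral.integral_const_mul,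
      intervalIntegral.integral_of_le, ← integral_Icc_eq_integral_Ioc,
      ← integral_indicator measurableSet_Icc]
    · rcases le_or_gt 0 ((1 - x) ^ 2 / 4 - t / x ^ 2) with hR | hR
      · congr 1
        ext y
        refine indicator_eq_indicator ?_ rfl
        rw [mem_Δset_iff ht hx.1, ← Real.sqrt_le_sqrt_iff hR, Real.sqrt_sq_eq_abs, abs_le,
          sliceRadius, mem_Icc]
        constructor
        · rintro ⟨⟨h1, h2⟩, -⟩
          constructor <;> linarith
        · rintro ⟨h1, h2⟩
          exact ⟨⟨by linarith, by linarith⟩, hx.2⟩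
      · rw [integral_indicator measurableSet_Icc, sliceRadius, Real.sqrt_eq_zero_of_nonpos hR.le]
        simp only [sub_zero, add_zero, Icc_self, Measure.restrict_singleton, Real.volume_singleton,
          zero_smul, integral_zero_measure]
        refine integral_eq_zero_of_ae (.of_forall fun y => indicator_of_notMem ?_ _)
        rw [mem_Δset_iff ht hx.1]
        rintro ⟨h, -⟩
        nlinarith [sq_nonneg (y - (1 - x) / 2)]
    · have : 0 ≤ sliceRadius t x := Real.sqrt_nonneg _
      linarith
  · rw [indicator_of_notMem hx]
    refine integral_eq_zero_of_ae (.of_forall fun y => indicator_of_notMem ?_ _)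
    exact fun h => hx (Δset_subset ht h).1

lemma intervalIntegrable_pow_mul_sliceRadius {t : ℝ} (ht : 0 < t) (n : ℕ) :
    IntervalIntegrable (fun x => x ^ n * (2 * sliceRadius t x)) volume 0 1 := by
  rw [intervalIntegrable_iff_integrableOn_Ioc_of_le zero_le_one]
  refine IntegrableOn.of_bound (by simp) ?_ 1 ?_
  · unfold sliceRadius
    exact Measurable.aestronglyMeasurable (by fun_prop)
  · refine (ae_restrict_iff' measurableSet_Ioc).2 (.of_forall fun x hx => ?_)
    have h0 : 0 ≤ sliceRadius t x := Real.sqrt_nonneg _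
    have h1 : 2 * sliceRadius t x ≤ 1 := by
      have : sliceRadius t x ≤ 1 / 2 := by
        refine Real.sqrt_le_iff.2 ⟨by norm_num, ?_⟩
        have : 0 ≤ t / x ^ 2 := by positivity
        nlinarith [hx.1, hx.2]
      linarith
    rw [Real.norm_of_nonneg (mul_nonneg (pow_nonneg hx.1.le n) (by linarith))]
    exact mul_le_one₀ (pow_le_one₀ hx.1.le hx.2) (by linarith) h1

lemma Iab_zero_right {t : ℝ} (ht : 0 < t) (n : ℕ) :
    Iab n 0 t = ∫ x in (0 : ℝ)..1, x ^ n * (2 * sliceRadius t x) := by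
  rw [← Nat.cast_zero, Iab_eq_intervalIntegral ht]
  congr 1
  ext x
  push_cast
  ring

lemma Iab_one_right {t : ℝ} (ht : 0 < t) (n : ℕ) :
    Iab n 1 t = (Iab n 0 t - Iab (n + 1 : ℕ) 0 t) / 2 := by
  have hi := intervalIntegrable_pow_mul_sliceRadius ht
  rw [Iab_zero_right ht, Iab_zero_right ht, ← intervalIntegral.integral_sub (hi _) (hi _),
    ← intervalIntegral.integral_div, ← Nat.cast_one, Iab_eq_intervalIntegral ht]
  congr 1
  ext x
  push_cast
  ring

lemma Iab_two_right {t : ℝ} (ht : 0 < t) (n : ℕ) :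
    Iab (n + 2 : ℕ) 2 t = (Iab (n + 2 : ℕ) 0 t - 2 * Iab (n + 3 : ℕ) 0 t + Iab (n + 4 : ℕ) 0 t
      - t * Iab n 0 t) / 3 := by
  have hi := intervalIntegrable_pow_mul_sliceRadius ht
  simp only [Iab_zero_right ht]
  rw [show (2 : ℤ) = (2 : ℕ) from rfl, Iab_eq_intervalIntegral ht]
  rw [← intervalIntegral.integral_const_mul, ← intervalIntegral.integral_const_mul,
    ← intervalIntegral.integral_sub (hi _) ((hi _).const_mul _),
    ← intervalIntegral.integral_add ((hi _).sub ((hi _).const_mul _)) (hi _),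
    ← intervalIntegral.integral_sub (((hi _).sub ((hi _).const_mul _)).add (hi _))
      ((hi _).const_mul _),
    ← intervalIntegral.integral_div]
  refine intervalIntegral.integral_congr_ae (.of_forall fun x hx => ?_)
  rw [uIoc_of_le zero_le_one] at hx
  have hx0 : x ≠ 0 := hx.1.ne'
  have hcube : x ^ 2 * sliceRadius t x ^ 3 =
      (x ^ 2 * (1 - x) ^ 2 / 4 - t) * sliceRadius t x := by
    rcases le_total 0 ((1 - x) ^ 2 / 4 - t / x ^ 2) with hR | hR
    · rw [pow_succ (sliceRadius t x), sliceRadius, Real.sq_sqrt hR]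
      field_simp
    · rw [sliceRadius, Real.sqrt_eq_zero_of_nonpos hR]
      ring
  push_cast
  linear_combination (2 / 3) * x ^ n * hcube

/-- The moments of `√(x² (1 - x)² / 4 - t)` over `[0, 1]`. -/
noncomputable def sqrtMoment (t : ℝ) (n : ℕ) : ℝ :=
  ∫ x in (0 : ℝ)..1, x ^ n * √(x ^ 2 * (1 - x) ^ 2 / 4 - t)

lemma Iab_succ_zero {t : ℝ} (ht : 0 < t) (n : ℕ) :
    Iab (n + 1 : ℕ) 0 t = 2 * sqrtMoment t n := by
  rw [Iab_zero_right ht, sqrtMoment, ← intervalIntegral.integral_const_mul]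
  refine intervalIntegral.integral_congr_ae (.of_forall fun x hx => ?_)
  rw [uIoc_of_le zero_le_one] at hx
  have hx0 : x ≠ 0 := hx.1.ne'
  have : √(x ^ 2 * (1 - x) ^ 2 / 4 - t) = x * sliceRadius t x := by
    rw [sliceRadius, ← Real.sqrt_sq hx.1.le, ← Real.sqrt_mul (sq_nonneg x), Real.sqrt_sq hx.1.le]
    congr 1
    field_simp
  rw [this]
  ring

lemma sqrtMoment_zero (t : ℝ) : sqrtMoment t 0 = 2 * sqrtMoment t 1 := by
  have hi (n : ℕ) : IntervalIntegrable
      (fun x : ℝ => x ^ n * √(x ^ 2 * (1 - x) ^ 2 / 4 - t)) volume 0 1 :=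
    Continuous.intervalIntegrable (by fun_prop) _ _
  have h : sqrtMoment t 1 = sqrtMoment t 0 - sqrtMoment t 1 := by
    conv_lhs => rw [sqrtMoment]
    rw [sqrtMoment, sqrtMoment, ← intervalIntegral.integral_sub (hi _) (hi _)]
    have := intervalIntegral.integral_comp_sub_left (a := 0) (b := 1)
      (fun x : ℝ => x ^ 1 * √(x ^ 2 * (1 - x) ^ 2 / 4 - t)) 1
    rw [sub_self, sub_zero] at this
    rw [← this]
    congr 1
    ext x
    rw [show (1 - x) ^ 2 * (1 - (1 - x)) ^ 2 = x ^ 2 * (1 - x) ^ 2 by ring]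
    ring
  linarith

lemma hasDerivAt_mul_sqrt (u : ℝ) : HasDerivAt (fun u : ℝ => u * √u) (3 / 2 * √u) u := by
  rcases eq_or_ne u 0 with rfl | hu
  · rw [hasDerivAt_iff_tendsto_slope]
    have h : Tendsto (fun u : ℝ => √u) (nhdsWithin 0 {0}ᶜ) (nhds (3 / 2 * √0)) := by
      have := (Real.continuous_sqrt.tendsto 0).mono_left
        (nhdsWithin_le_nhds (s := ({0}ᶜ : Set ℝ)))
      simpa using this
    refine h.congr' ?_
    filter_upwards [self_mem_nhdsWithin] with v hv
    have hv : v ≠ 0 := hv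
    simp [slope_def_field, hv]
  · refine ((hasDerivAt_id u).mul (Real.hasDerivAt_sqrt hu)).congr_deriv ?_
    rcases le_total 0 u with h | h
    · have h' : √u ≠ 0 := (Real.sqrt_pos.2 (lt_of_le_of_ne h hu.symm)).ne'
      simp only [id]
      field_simp
      linear_combination -Real.sq_sqrt h
    · simp [Real.sqrt_eq_zero_of_nonpos h]

lemma hasDerivAt_oval_mul_sqrt (t x : ℝ) :
    HasDerivAt (fun x : ℝ => (x ^ 2 * (1 - x) ^ 2 / 4 - t) * √(x ^ 2 * (1 - x) ^ 2 / 4 - t))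
      (3 / 4 * (x ^ 1 * √(x ^ 2 * (1 - x) ^ 2 / 4 - t)
        - 3 * (x ^ 2 * √(x ^ 2 * (1 - x) ^ 2 / 4 - t))
        + 2 * (x ^ 3 * √(x ^ 2 * (1 - x) ^ 2 / 4 - t)))) x := by
  have h1 : HasDerivAt (fun x : ℝ => x ^ 2) (2 * x) x := by
    simpa using hasDerivAt_pow 2 x
  have h2 : HasDerivAt (fun x : ℝ => (1 - x) ^ 2) (2 * (1 - x) * -1) x :=
    (((hasDerivAt_id x).const_sub 1).pow 2).congr_deriv (by simp)
  have hQ := ((h1.mul h2).div_const 4).sub_const t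
  exact ((hasDerivAt_mul_sqrt _).comp x hQ).congr_deriv (by simp only [Pi.mul_apply]; ring)

/-- Integration of the derivative of `Q * √Q` for `Q = x² (1 - x)² / 4 - t`. -/
lemma sqrtMoment_three {t : ℝ} (ht : 0 < t) :
    sqrtMoment t 1 - 3 * sqrtMoment t 2 + 2 * sqrtMoment t 3 = 0 := by
  have hi (n : ℕ) : IntervalIntegrable
      (fun x : ℝ => x ^ n * √(x ^ 2 * (1 - x) ^ 2 / 4 - t)) volume 0 1 :=
    Continuous.intervalIntegrable (by fun_prop) _ _
  have h := intervalIntegral.integral_eq_sub_of_hasDerivAt (a := 0) (b := 1)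
    (fun x _ => hasDerivAt_oval_mul_sqrt t x) (Continuous.intervalIntegrable (by fun_prop) _ _)
  have hs (x : ℝ) (hx : x ^ 2 * (1 - x) ^ 2 = 0) : √(x ^ 2 * (1 - x) ^ 2 / 4 - t) = 0 :=
    Real.sqrt_eq_zero_of_nonpos (by rw [hx]; linarith)
  rw [hs 0 (by norm_num), hs 1 (by norm_num), intervalIntegral.integral_const_mul,
    intervalIntegral.integral_add ((hi _).sub ((hi _).const_mul _)) ((hi _).const_mul _),
    intervalIntegral.integral_sub (hi _) ((hi _).const_mul _)] at h
  simp only [intervalIntegral.integral_const_mul] at h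
  simp only [sqrtMoment]
  linarith

/-- Integration of the derivative of `x ^ (m + 1) * Q * √Q` for `Q = x² (1 - x)² / 4 - t`. -/
lemma sqrtMoment_recurrence {t : ℝ} (ht : 0 < t) (m : ℕ) :
    (m + 4) * sqrtMoment t (m + 2) - (2 * m + 11) * sqrtMoment t (m + 3)
      + (m + 7) * sqrtMoment t (m + 4) = 4 * (m + 1) * t * sqrtMoment t m := by
  set s : ℝ → ℝ := fun x => √(x ^ 2 * (1 - x) ^ 2 / 4 - t) with hs
  have hi (n : ℕ) : IntervalIntegrable (fun x : ℝ => x ^ n * s x) volume 0 1 :=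
    Continuous.intervalIntegrable (by fun_prop) _ _
  have hd (x : ℝ) : HasDerivAt (fun x => 4 * (x ^ (m + 1) *
      ((x ^ 2 * (1 - x) ^ 2 / 4 - t) * s x)))
      ((m + 4) * (x ^ (m + 2) * s x) - (2 * m + 11) * (x ^ (m + 3) * s x)
        + (m + 7) * (x ^ (m + 4) * s x) - 4 * (m + 1) * t * (x ^ m * s x)) x := by
    refine (((hasDerivAt_pow (m + 1) x).mul (hasDerivAt_oval_mul_sqrt t x)).const_mul
      4).congr_deriv ?_
    simp only [hs, Nat.add_sub_cancel]
    push_cast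
    ring
  have h := intervalIntegral.integral_eq_sub_of_hasDerivAt (a := 0) (b := 1) (fun x _ => hd x)
    (Continuous.intervalIntegrable (by fun_prop) _ _)
  rw [intervalIntegral.integral_sub ((((hi _).const_mul _).sub ((hi _).const_mul _)).add
      ((hi _).const_mul _)) ((hi _).const_mul _),
    intervalIntegral.integral_add (((hi _).const_mul _).sub ((hi _).const_mul _))
      ((hi _).const_mul _),
    intervalIntegral.integral_sub ((hi _).const_mul _) ((hi _).const_mul _)] at h
  simp only [intervalIntegral.integral_const_mul] at h
  have hs1 : s 1 = 0 := Real.sqrt_eq_zero_of_nonpos (by norm_num; exact ht.le)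
  simp only [hs1, mul_zero, ne_eq, Nat.add_eq_zero_iff, one_ne_zero, and_false,
    not_false_eq_true, zero_pow, zero_mul, sub_zero] at h
  exact sub_eq_zero.1 h

/-- the eight explicit decompositions (12) of the paper. -/
theorem abelian_integral_explicit_decompositions (t : ℝ)
    (ht : t ∈ Set.Ioo (0 : ℝ) (1 / 64)) :
    Iab 2 1 t = (1 / 2) * J2 t - (1 / 2) * J3 t ∧
    Iab 3 1 t = (1 / 4) * J2 t - (1 / 4) * J3 t ∧
    Iab 4 1 t = (1 / 7) * J2 t - (1 / 7) * J3 t - (4 / 7) * t * J2 t ∧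
    Iab 5 1 t = (5 / 56) * J2 t - (5 / 56) * J3 t - (6 / 7) * t * J2 t ∧
    Iab 6 1 t = (5 / 84) * J2 t - (5 / 84) * J3 t - (4 / 7) * t * J2 t - (2 / 3) * t * J3 t ∧
    Iab 2 2 t = (1 / 6) * J2 t - (1 / 6) * J3 t - (1 / 3) * t * J1 t ∧
    Iab 4 2 t = (1 / 28) * J2 t - (1 / 28) * J3 t - (1 / 7) * t * J2 t ∧
    Iab 5 2 t = (5 / 252) * J2 t - (5 / 252) * J3 t - (4 / 21) * t * J2 t + (1 / 9) * t * J3 t := by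
  have ht0 := ht.1
  have K2 := Iab_succ_zero ht0 1
  have K3 := Iab_succ_zero ht0 2
  have K4 := Iab_succ_zero ht0 3
  have K5 := Iab_succ_zero ht0 4
  have K6 := Iab_succ_zero ht0 5
  have K7 := Iab_succ_zero ht0 6
  have A2 := Iab_one_right ht0 2
  have A3 := Iab_one_right ht0 3
  have A4 := Iab_one_right ht0 4
  have A5 := Iab_one_right ht0 5
  have A6 := Iab_one_right ht0 6
  have B2 := Iab_two_right ht0 0
  have B4 := Iab_two_right ht0 2
  have B5 := Iab_two_right ht0 3
  have R0 := sqrtMoment_recurrence ht0 0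
  have R1 := sqrtMoment_recurrence ht0 1
  have R2 := sqrtMoment_recurrence ht0 2
  have R := sqrtMoment_three ht0
  norm_num at K2 K3 K4 K5 K6 K7 A2 A3 A4 A5 A6 B2 B4 B5 R0 R1 R2
  rw [sqrtMoment_zero] at R0
  simp only [J1, J2, J3, A2, A3, A4, A5, A6, B2, B4, B5, K2, K3, K4, K5, K6, K7]
  refine ⟨?_, ?_, ?_, ?_, ?_, ?_, ?_, ?_⟩ <;> linarith
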